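/- Optimal Policy Invariance: a policy π* is optimal for the original reward r (meaning: for every policy π and every state s, V^π s ≤ V^{π*} s) if and only if π* is optimal for the shaped reward r' (meaning: for every policy π and every state s, V'^π s ≤ V'^{π*} s). -/

import Mathlib

open scoped BigOperators

variable {S A : Type*}

/-- Induced state-transition matrix of a policy: `(Pmat P pol) s s' = ∑ a, pol s a * P s a s'`. -/
noncomputable def Pmat [Fintype A] (P : S → A → S → ℝ) (pol : S → A → ℝ) :
    Matrix S S ℝ :=
  Matrix.of fun s s' => ∑ a, pol s a * P s a s'

/-- Induced reward vector of a policy: `(rvec r pol) s = ∑ a, pol s a * r s a`. -/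
noncomputable def rvec [Fintype A] (r : S → A → ℝ) (pol : S → A → ℝ) : S → ℝ :=
  fun s => ∑ a, pol s a * r s a

/-- Value function: `V^π s = ∑' t, γ^t * ((P_π)^t r_π) s`. -/
noncomputable def Vval [Fintype S] [DecidableEq S] [Fintype A]
    (P : S → A → S → ℝ) (r : S → A → ℝ) (γ : ℝ) (pol : S → A → ℝ) : S → ℝ :=
  fun s => ∑' t : ℕ, γ ^ t * ((Pmat P pol ^ t).mulVec (rvec r pol)) s

/-- Action-value function: `Q^π s a = r s a + γ * ∑ s', P s a s' * V^π s'`. -/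
noncomputable def Qval [Fintype S] [DecidableEq S] [Fintype A]
    (P : S → A → S → ℝ) (r : S → A → ℝ) (γ : ℝ) (pol : S → A → ℝ) : S → A → ℝ :=
  fun s a => r s a + γ * ∑ s', P s a s' * Vval P r γ pol s'

/-- Advantage function: `A^π s a = Q^π s a - V^π s`. -/
noncomputable def Adv [Fintype S] [DecidableEq S] [Fintype A]
    (P : S → A → S → ℝ) (r : S → A → ℝ) (γ : ℝ) (pol : S → A → ℝ) : S → A → ℝ :=
  fun s a => Qval P r γ pol s a - Vval P r γ pol s

/-- Discounted state-visitation distribution from start state `s₀`. -/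
noncomputable def dvisit [Fintype S] [DecidableEq S] [Fintype A]
    (P : S → A → S → ℝ) (γ : ℝ) (pol : S → A → ℝ) (s₀ : S) : S → ℝ :=
  fun s => (1 - γ) * ∑' t : ℕ, γ ^ t * (Pmat P pol ^ t) s₀ s

/-- Discounted state-visitation distribution under an initial distribution `ρ`. -/
noncomputable def dvisitInit [Fintype S] [DecidableEq S] [Fintype A]
    (P : S → A → S → ℝ) (γ : ℝ) (pol : S → A → ℝ) (ρ : S → ℝ) : S → ℝ :=
  fun s => ∑ s₀, ρ s₀ * dvisit P γ pol s₀ s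

/-- Potential-based shaped reward:
`r' s a = r s a + α * (γ * ∑ s', P s a s' * Φ s' - Φ s)`. -/
noncomputable def shaped [Fintype S] (P : S → A → S → ℝ) (r : S → A → ℝ) (γ : ℝ)
    (Φ : S → ℝ) (α : ℝ) : S → A → ℝ :=
  fun s a => r s a + α * (γ * ∑ s', P s a s' * Φ s' - Φ s)

/-- Softmax distribution on a finite type. -/
noncomputable def softmax [Fintype A] (θ : A → ℝ) (a : A) : ℝ :=
  Real.exp (θ a) / ∑ b, Real.exp (θ b)

/-- Partition function of the exponentially tilted (NPG) update. -/
noncomputable def Zfun [Fintype S] [DecidableEq S] [Fintype A]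
    (P : S → A → S → ℝ) (r : S → A → ℝ) (γ : ℝ) (pol : S → A → ℝ)
    (F : S → A → ℝ) (α β : ℝ) (s : S) : ℝ :=
  ∑ a, pol s a * Real.exp (β * (Adv P r γ pol s a + α * F s a) / (1 - γ))

/-- Exponentially tilted (NPG) policy update. -/
noncomputable def tilted [Fintype S] [DecidableEq S] [Fintype A]
    (P : S → A → S → ℝ) (r : S → A → ℝ) (γ : ℝ) (pol : S → A → ℝ)
    (F : S → A → ℝ) (α β : ℝ) (s : S) (a : A) : ℝ :=
  pol s a * Real.exp (β * (Adv P r γ pol s a + α * F s a) / (1 - γ)) /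
    Zfun P r γ pol F α β s


lemma Pmat_mem_rowStochastic [Fintype S] [DecidableEq S] [Fintype A]
    {P : S → A → S → ℝ} (hP0 : ∀ s a s', 0 ≤ P s a s') (hP1 : ∀ s a, ∑ s', P s a s' = 1)
    {π : S → A → ℝ} (h0 : ∀ s a, 0 ≤ π s a) (h1 : ∀ s, ∑ a, π s a = 1) :
    Pmat P π ∈ Matrix.rowStochastic ℝ S := by
  rw [Matrix.mem_rowStochastic_iff_sum]
  refine ⟨fun s s' => Finset.sum_nonneg fun a _ => mul_nonneg (h0 s a) (hP0 s a s'), fun s => ?_⟩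
  simp only [Pmat, Matrix.of_apply]
  rw [Finset.sum_comm]
  simp [← Finset.mul_sum, hP1, h1]

lemma abs_mulVec_le_of_mem_rowStochastic [Fintype S] [DecidableEq S]
    {M : Matrix S S ℝ} (hM : M ∈ Matrix.rowStochastic ℝ S) (v : S → ℝ) (s : S) :
    |M.mulVec v s| ≤ ‖v‖ := by
  calc |∑ s', M s s' * v s'| ≤ ∑ s', |M s s' * v s'| := Finset.abs_sum_le_sum_abs _ _
    _ ≤ ∑ s', M s s' * ‖v‖ := by
        refine Finset.sum_le_sum fun s' _ => ?_
        have hnonneg : 0 ≤ M s s' := Matrix.nonneg_of_mem_rowStochastic hM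
        rw [abs_mul, abs_of_nonneg hnonneg]
        exact mul_le_mul_of_nonneg_left (norm_le_pi_norm v s') hnonneg
    _ = ‖v‖ := by
        rw [← Finset.sum_mul, Matrix.sum_row_of_mem_rowStochastic hM, one_mul]

lemma summable_discounted_mulVec [Fintype S] [DecidableEq S]
    {M : Matrix S S ℝ} (hM : M ∈ Matrix.rowStochastic ℝ S)
    {γ : ℝ} (hγ0 : 0 ≤ γ) (hγ1 : γ < 1) (v : S → ℝ) (s : S) :
    Summable fun t : ℕ => γ ^ t * (M ^ t).mulVec v s := by
  refine Summable.of_norm_bounded ((summable_geometric_of_lt_one hγ0 hγ1).mul_right ‖v‖)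
    fun t => ?_
  rw [Real.norm_eq_abs, abs_mul, abs_of_nonneg (pow_nonneg hγ0 t)]
  exact mul_le_mul_of_nonneg_left (abs_mulVec_le_of_mem_rowStochastic (pow_mem hM t) v s)
    (pow_nonneg hγ0 t)

lemma rvec_shaped [Fintype S] [Fintype A]
    (P : S → A → S → ℝ) (r : S → A → ℝ) (γ : ℝ) (Φ : S → ℝ) (α : ℝ)
    {π : S → A → ℝ} (h1 : ∀ s, ∑ a, π s a = 1) :
    rvec (shaped P r γ Φ α) π = rvec r π + α • (γ • (Pmat P π).mulVec Φ - Φ) := by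
  funext s
  have hM : (Pmat P π).mulVec Φ s = ∑ a, π s a * ∑ s', P s a s' * Φ s' := by
    simp only [Matrix.mulVec, dotProduct, Pmat, Matrix.of_apply, Finset.sum_mul, Finset.mul_sum]
    rw [Finset.sum_comm]
    simp only [mul_assoc]
  have hΦ : Φ s = ∑ a, π s a * Φ s := by rw [← Finset.sum_mul, h1, one_mul]
  simp only [Pi.add_apply, Pi.smul_apply, Pi.sub_apply, smul_eq_mul, hM]
  conv_rhs => rw [hΦ]
  simp only [rvec, shaped]
  rw [Finset.mul_sum, ← Finset.sum_sub_distrib, Finset.mul_sum, ← Finset.sum_add_distrib]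
  exact Finset.sum_congr rfl fun a _ => by ring

lemma Vval_shaped [Fintype S] [DecidableEq S] [Fintype A]
    {P : S → A → S → ℝ} (hP0 : ∀ s a s', 0 ≤ P s a s') (hP1 : ∀ s a, ∑ s', P s a s' = 1)
    (r : S → A → ℝ) {γ : ℝ} (hγ0 : 0 ≤ γ) (hγ1 : γ < 1) (Φ : S → ℝ) (α : ℝ)
    {π : S → A → ℝ} (h0 : ∀ s a, 0 ≤ π s a) (h1 : ∀ s, ∑ a, π s a = 1) (s : S) :
    Vval P (shaped P r γ Φ α) γ π s = Vval P r γ π s - α * Φ s := by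
  have hM := Pmat_mem_rowStochastic hP0 hP1 h0 h1
  have hr := summable_discounted_mulVec hM hγ0 hγ1 (rvec r π) s
  have hΦ := summable_discounted_mulVec hM hγ0 hγ1 Φ s
  have hΦ' := (summable_nat_add_iff 1).2 hΦ
  have hterm (t : ℕ) : γ ^ t * (Pmat P π ^ t).mulVec (rvec (shaped P r γ Φ α) π) s =
      γ ^ t * (Pmat P π ^ t).mulVec (rvec r π) s +
        α * (γ ^ (t + 1) * (Pmat P π ^ (t + 1)).mulVec Φ s -
          γ ^ t * (Pmat P π ^ t).mulVec Φ s) := by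
    rw [rvec_shaped P r γ Φ α h1, Matrix.mulVec_add, Matrix.mulVec_smul, Matrix.mulVec_sub,
      Matrix.mulVec_smul, Matrix.mulVec_mulVec, ← pow_succ]
    simp only [Pi.add_apply, Pi.smul_apply, Pi.sub_apply, smul_eq_mul]
    ring
  have hshift := hΦ.tsum_eq_zero_add
  simp only [pow_zero, Matrix.one_mulVec, one_mul] at hshift
  simp only [Vval, hterm]
  rw [hr.tsum_add ((hΦ'.sub hΦ).mul_left α), tsum_mul_left, hΦ'.tsum_sub hΦ, hshift]
  ring

theorem optimal_policy_invariance [Fintype S] [DecidableEq S] [Nonempty S] [Fintype A] [Nonempty A]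
    (P : S → A → S → ℝ) (hP0 : ∀ s a s', 0 ≤ P s a s') (hP1 : ∀ s a, ∑ s', P s a s' = 1)
    (r : S → A → ℝ) (γ : ℝ) (hγ0 : 0 ≤ γ) (hγ1 : γ < 1)
    (Φ : S → ℝ) (α : ℝ)
    (πstar : S → A → ℝ) (hstar0 : ∀ s a, 0 ≤ πstar s a)
    (hstar1 : ∀ s, ∑ a, πstar s a = 1) :
    (∀ π : S → A → ℝ, (∀ s a, 0 ≤ π s a) → (∀ s, ∑ a, π s a = 1) →
        ∀ s, Vval P r γ π s ≤ Vval P r γ πstar s) ↔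
      (∀ π : S → A → ℝ, (∀ s a, 0 ≤ π s a) → (∀ s, ∑ a, π s a = 1) →
        ∀ s, Vval P (shaped P r γ Φ α) γ π s ≤ Vval P (shaped P r γ Φ α) γ πstar s) := by
  refine forall_congr' fun π => forall_congr' fun h0 => forall_congr' fun h1 =>
    forall_congr' fun s => ?_
  rw [Vval_shaped hP0 hP1 r hγ0 hγ1 Φ α h0 h1, Vval_shaped hP0 hP1 r hγ0 hγ1 Φ α hstar0 hstar1,
    sub_le_sub_iff_right]
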